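/- Let H be a real m × n matrix, y ∈ ℝᵐ, let S ⊆ ℝⁿ be a finite signal set, and suppose d_ML is the unique minimizer of ‖y − Hd‖ over S. If d ∈ 𝕄_K for some 1 ≤ K ≤ n and d ≠ d_ML, then d and d_ML differ in at least K + 1 coordinates (their Hamming distance is ≥ K + 1). -/

import Mathlib

open Matrix

/-- Euclidean norm of a real vector indexed by `Fin m`. -/
noncomputable def eNorm {m : ℕ} (v : Fin m → ℝ) : ℝ :=
  Real.sqrt (∑ i, (v i) ^ 2)

/-- Number of coordinates in which two vectors differ. -/
noncomputable def diffCount {n : ℕ} (d d' : Fin n → ℝ) : ℕ :=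
  (Finset.univ.filter fun i => d' i ≠ d i).card

/-- The set `𝕃_K` of vectors `d ∈ S` such that no update of exactly `K`
coordinates (staying in `S`) can decrease the ML cost `‖y − Hd‖`. -/
def LSet {m n : ℕ} (H : Matrix (Fin m) (Fin n) ℝ) (y : Fin m → ℝ)
    (S : Finset (Fin n → ℝ)) (K : ℕ) : Set (Fin n → ℝ) :=
  {d | d ∈ S ∧ ∀ d' ∈ S, diffCount d d' = K →
    eNorm (y - H *ᵥ d) ≤ eNorm (y - H *ᵥ d')}

/-- The set `𝕄_K = ⋂_{j=1}^{K} 𝕃_j`. -/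
def MSet {m n : ℕ} (H : Matrix (Fin m) (Fin n) ℝ) (y : Fin m → ℝ)
    (S : Finset (Fin n → ℝ)) (K : ℕ) : Set (Fin n → ℝ) :=
  ⋂ j ∈ Finset.Icc 1 K, LSet H y S j

/-- Distinct vectors differ in at least one coordinate. -/
theorem diffCount_pos {n : ℕ} {d d' : Fin n → ℝ} (h : d ≠ d') : 1 ≤ diffCount d d' := by
  obtain ⟨i, hi⟩ := Function.ne_iff.mp h
  exact Finset.card_pos.mpr ⟨i, by simpa using hi.symm⟩

/-- If `d_ML` is the unique minimizer of `‖y − Hd‖` over `S` and `d ∈ 𝕄_K`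
for some `1 ≤ K ≤ n` with `d ≠ d_ML`, then `d` and `d_ML` differ in at least
`K + 1` coordinates. -/
theorem MSet_mem_hamming_distance {m n : ℕ}
    (H : Matrix (Fin m) (Fin n) ℝ) (y : Fin m → ℝ) (S : Finset (Fin n → ℝ))
    (dML : Fin n → ℝ) (hmem : dML ∈ S)
    (hmin : ∀ d ∈ S, d ≠ dML → eNorm (y - H *ᵥ dML) < eNorm (y - H *ᵥ d))
    (K : ℕ) (hK1 : 1 ≤ K) (hKn : K ≤ n)
    (d : Fin n → ℝ) (hd : d ∈ MSet H y S K) (hne : d ≠ dML) :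
    K + 1 ≤ diffCount d dML := by
  by_contra! hlt
  have hL : ∀ j ∈ Finset.Icc 1 K, d ∈ LSet H y S j := by
    simpa only [MSet, Set.mem_iInter] using hd
  obtain ⟨hdS, hle⟩ := hL (diffCount d dML)
    (Finset.mem_Icc.mpr ⟨diffCount_pos hne, Nat.le_of_lt_succ hlt⟩)
  exact (hmin d hdS hne).not_ge (hle dML hmem rfl)
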